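/- Let Γ be an n-space group, let N be a normal subgroup of Γ, and let V = Span(N). Then the map N → Isom(V) sending ν = a + A to ν̄ = a + A|_V is an injective group homomorphism, and its image N̄ is a discrete subgroup of the isometry group of V with compact orbit space V/N̄. Consequently N acts effectively on each coset V + x of V in Eⁿ as a space group of isometries of V + x. -/

import Mathlib

noncomputable section

/-- The translation `x ↦ a + x` of a normed additive group, as an isometry. -/
def transIso {X : Type*} [SeminormedAddCommGroup X] (a : X) : X ≃ᵢ X :=
  IsometryEquiv.constVAdd a

@[simp] lemma transIso_apply {X : Type*} [SeminormedAddCommGroup X] (a x : X) :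
    transIso a x = a + x := rfl

/-- `parts φ a A` means that the isometry `φ` is `a + A`, i.e. `φ x = a + A x` for all `x`. -/
def parts {X : Type*} [NormedAddCommGroup X] [InnerProductSpace ℝ X]
    (φ : X ≃ᵢ X) (a : X) (A : X ≃ₗᵢ[ℝ] X) : Prop :=
  ∀ x, φ x = a + A x

/-- The span of a group of isometries: the real span of the set of translation vectors of
the translations belonging to the group. -/
def spanOf {X : Type*} [NormedAddCommGroup X] [InnerProductSpace ℝ X]
    (H : Subgroup (X ≃ᵢ X)) : Submodule ℝ X :=
  Submodule.span ℝ {a : X | transIso a ∈ H}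

/-- A space group: a group of isometries acting discontinuously (the discreteness condition)
with compact quotient (expressed by a compact set meeting every orbit). -/
def IsSpaceGroup {X : Type*} [MetricSpace X] (Γ : Subgroup (X ≃ᵢ X)) : Prop :=
  (∀ K : Set X, IsCompact K →
    {γ : X ≃ᵢ X | γ ∈ Γ ∧ ((γ : X → X) '' K ∩ K).Nonempty}.Finite) ∧
  ∃ K : Set X, IsCompact K ∧ ∀ x : X, ∃ γ ∈ Γ, (γ : X → X) x ∈ K

/-- `N` is a complete normal subgroup of `Γ`: it is normal in `Γ` and consists exactly of
those `a + A ∈ Γ` with `a ∈ Span N` and `A` fixing `(Span N)ᗮ` pointwise. -/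
def IsCompleteNormal {X : Type*} [NormedAddCommGroup X] [InnerProductSpace ℝ X]
    (Γ N : Subgroup (X ≃ᵢ X)) : Prop :=
  N ≤ Γ ∧ (∀ γ ∈ Γ, ∀ ν ∈ N, γ * ν * γ⁻¹ ∈ N) ∧
  ∀ φ ∈ Γ, ∀ (a : X) (A : X ≃ₗᵢ[ℝ] X), parts φ a A →
    (φ ∈ N ↔ a ∈ spanOf N ∧ ∀ w ∈ (spanOf N)ᗮ, A w = w)

/-- The real span of the set of translation vectors of the central translations of `N`,
i.e. `Span(Z(N))`. -/
def centerSpan {X : Type*} [NormedAddCommGroup X] [InnerProductSpace ℝ X]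
    (N : Subgroup (X ≃ᵢ X)) : Submodule ℝ X :=
  Submodule.span ℝ
    {u : X | ∃ h : transIso u ∈ N, (⟨transIso u, h⟩ : N) ∈ Subgroup.center N}

section Isometries

variable {X : Type*} [NormedAddCommGroup X] [InnerProductSpace ℝ X]

/-- The operator `A - 1`, where `A` is the linear part of the isometry `φ = a + A`. -/
def rotDefect (φ : X ≃ᵢ X) : X →L[ℝ] X :=
  (φ.toRealLinearIsometryEquiv.toContinuousLinearEquiv : X →L[ℝ] X) -
    ContinuousLinearMap.id ℝ X

lemma rotDefect_apply (φ : X ≃ᵢ X) (x : X) :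
    rotDefect φ x = φ.toRealLinearIsometryEquiv x - x := rfl

lemma apply_eq_add_linearPart (φ : X ≃ᵢ X) (x : X) :
    φ x = φ 0 + φ.toRealLinearIsometryEquiv x := by simp

lemma apply_add (φ : X ≃ᵢ X) (x y : X) :
    φ (x + y) = φ x + φ.toRealLinearIsometryEquiv y := by
  rw [apply_eq_add_linearPart φ (x + y), apply_eq_add_linearPart φ x, map_add, add_assoc]

lemma linearPart_mul_apply (φ ψ : X ≃ᵢ X) (x : X) :
    (φ * ψ).toRealLinearIsometryEquiv x =
      φ.toRealLinearIsometryEquiv (ψ.toRealLinearIsometryEquiv x) := by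
  rw [IsometryEquiv.toRealLinearIsometryEquiv_apply, IsometryEquiv.mul_apply,
    IsometryEquiv.mul_apply, apply_eq_add_linearPart ψ x, apply_add, add_sub_cancel_left]

lemma norm_rotDefect_le_two (φ : X ≃ᵢ X) : ‖rotDefect φ‖ ≤ 2 := by
  refine ContinuousLinearMap.opNorm_le_bound _ (by norm_num) fun x => ?_
  rw [rotDefect_apply]
  refine (norm_sub_le _ _).trans ?_
  rw [LinearIsometryEquiv.norm_map]
  linarith

lemma linearPart_eq_of_rotDefect_eq_zero {φ : X ≃ᵢ X} (h : rotDefect φ = 0) (x : X) :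
    φ.toRealLinearIsometryEquiv x = x := by
  have := rotDefect_apply φ x
  rw [h] at this
  exact (sub_eq_zero.1 this.symm)

lemma eq_transIso_of_rotDefect_eq_zero {φ : X ≃ᵢ X} (h : rotDefect φ = 0) :
    φ = transIso (φ 0) := by
  ext x
  rw [transIso_apply, apply_eq_add_linearPart, linearPart_eq_of_rotDefect_eq_zero h]

/-- Since `A - 1` is normal, the growth rate of its iterates on a vector is nondecreasing. -/
lemma norm_rotDefect_sq_le (φ : X ≃ᵢ X) (x : X) :
    ‖rotDefect φ x‖ ^ 2 ≤ ‖rotDefect φ (rotDefect φ x)‖ * ‖x‖ := by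
  set A := φ.toRealLinearIsometryEquiv
  set D := rotDefect φ
  have h1 : ‖D x‖ ^ 2 = inner ℝ (D x - A (D x)) (A x) := by
    rw [inner_sub_left, LinearIsometryEquiv.inner_map_map, ← inner_sub_right,
      ← real_inner_self_eq_norm_sq]
    rfl
  rw [h1]
  refine (real_inner_le_norm _ _).trans ?_
  rw [LinearIsometryEquiv.norm_map, norm_sub_rev]
  rfl

lemma norm_rotDefect_mul_inv_le (φ ψ : X ≃ᵢ X) :
    ‖rotDefect (φ * ψ⁻¹)‖ ≤ ‖rotDefect φ - rotDefect ψ‖ := by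
  refine ContinuousLinearMap.opNorm_le_bound _ (norm_nonneg _) fun x => ?_
  obtain ⟨y, rfl⟩ := ψ.toRealLinearIsometryEquiv.surjective x
  rw [rotDefect_apply, ← linearPart_mul_apply, inv_mul_cancel_right,
    LinearIsometryEquiv.norm_map]
  have := (rotDefect φ - rotDefect ψ).le_opNorm y
  rwa [sub_apply, rotDefect_apply, rotDefect_apply,
    sub_sub_sub_cancel_right] at this

lemma norm_rotDefect_commutator_le (φ ψ : X ≃ᵢ X) :
    ‖rotDefect (φ * ψ * φ⁻¹ * ψ⁻¹)‖ ≤ 2 * ‖rotDefect φ‖ * ‖rotDefect ψ‖ := by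
  refine ContinuousLinearMap.opNorm_le_bound _ (by positivity) fun x => ?_
  obtain ⟨z, rfl⟩ := ψ.toRealLinearIsometryEquiv.surjective x
  obtain ⟨y, rfl⟩ := φ.toRealLinearIsometryEquiv.surjective z
  rw [rotDefect_apply, ← linearPart_mul_apply, ← linearPart_mul_apply, inv_mul_cancel_right,
    inv_mul_cancel_right, LinearIsometryEquiv.norm_map, LinearIsometryEquiv.norm_map,
    linearPart_mul_apply]
  have key : φ.toRealLinearIsometryEquiv (ψ.toRealLinearIsometryEquiv y) -
      ψ.toRealLinearIsometryEquiv (φ.toRealLinearIsometryEquiv y) =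
      rotDefect φ (rotDefect ψ y) - rotDefect ψ (rotDefect φ y) := by
    simp only [rotDefect_apply, map_sub]
    abel
  rw [key]
  have h1 := (rotDefect φ).le_opNorm_of_le ((rotDefect ψ).le_opNorm y)
  have h2 := (rotDefect ψ).le_opNorm_of_le ((rotDefect φ).le_opNorm y)
  have h3 := norm_sub_le (rotDefect φ (rotDefect ψ y)) (rotDefect ψ (rotDefect φ y))
  linarith

/-- The translation part of a commutator `φ ψ φ⁻¹ ψ⁻¹` is `(A - 1) b` up to a controlled error,
where `A` is the linear part of `φ` and `b` is the translation part of `ψ`. -/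
lemma norm_commutator_zero_sub_le (φ ψ : X ≃ᵢ X) :
    ‖(φ * ψ * φ⁻¹ * ψ⁻¹) 0 - rotDefect φ (ψ 0)‖ ≤
      2 * ‖rotDefect φ‖ * ‖rotDefect ψ‖ * ‖ψ 0‖ + ‖rotDefect ψ‖ * ‖φ 0‖ := by
  have hcomm := norm_rotDefect_commutator_le φ ψ
  set c := φ * ψ * φ⁻¹ * ψ⁻¹ with hc
  have hcm : c * (ψ * φ) = φ * ψ := by rw [hc]; group
  obtain ⟨w, hw⟩ := φ.toRealLinearIsometryEquiv.surjective (φ 0)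
  have hlin : c.toRealLinearIsometryEquiv (ψ.toRealLinearIsometryEquiv (φ 0)) =
      φ.toRealLinearIsometryEquiv (ψ.toRealLinearIsometryEquiv w) := by
    rw [← hw, ← linearPart_mul_apply ψ, ← linearPart_mul_apply, hcm, linearPart_mul_apply]
  have hz : c (ψ (φ 0)) = φ (ψ 0) := by
    rw [← IsometryEquiv.mul_apply, ← IsometryEquiv.mul_apply, mul_assoc, hcm]
    rfl
  rw [apply_eq_add_linearPart c, apply_eq_add_linearPart ψ (φ 0), map_add, hlin,
    apply_eq_add_linearPart φ (ψ 0)] at hz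
  have key : c 0 - rotDefect φ (ψ 0) =
      -(rotDefect c (ψ 0)) - φ.toRealLinearIsometryEquiv (rotDefect ψ w) := by
    simp only [rotDefect_apply, map_sub]
    rw [hw, eq_sub_of_add_eq hz]
    abel
  have hwn : ‖w‖ = ‖φ 0‖ := by rw [← hw, LinearIsometryEquiv.norm_map]
  rw [key]
  refine (norm_sub_le _ _).trans (add_le_add ?_ ?_)
  · rw [norm_neg]
    exact (rotDefect c).le_of_opNorm_le hcomm _
  · rw [LinearIsometryEquiv.norm_map, ← hwn]
    exact (rotDefect ψ).le_opNorm w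

variable {N : Subgroup (X ≃ᵢ X)}

/-- If `φ - 1` takes values in `V` and `φ` fixes `V` pointwise then `φ = 1`. -/
lemma eq_one_of_apply_sub_mem {V : Submodule ℝ X} {φ : X ≃ᵢ X} (h : ∀ x, φ x - x ∈ V)
    (hfix : ∀ v ∈ V, φ v = v) : φ = 1 := by
  have h0 : φ 0 = 0 := hfix 0 V.zero_mem
  have hA : ∀ x, φ.toRealLinearIsometryEquiv x = φ x := fun x => by simp [h0]
  ext x
  refine sub_eq_zero.1 (inner_self_eq_zero (𝕜 := ℝ).1 ?_)
  change inner ℝ (φ x - x) (φ x - x) = 0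
  set v := φ x - x with hv
  have h1 : inner ℝ (φ x) v = inner ℝ x v := by
    rw [← φ.toRealLinearIsometryEquiv.inner_map_map x v, hA, hA, hfix v (h x)]
  conv_lhs => rw [hv]
  rw [inner_sub_left, h1, sub_self]

/-- The action by isometries on a subspace `V` of a group of isometries moving every point by a
vector of `V`. -/
def restrictHom (V : Submodule ℝ X) (h : ∀ ν ∈ N, ∀ x, ν x - x ∈ V) : N →* (V ≃ᵢ V) where
  toFun ν := IsometryEquiv.mk' (fun v => ⟨(ν : X ≃ᵢ X) v, by
        simpa using V.add_mem (h ν ν.2 v) v.2⟩)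
      (fun v => ⟨(ν : X ≃ᵢ X)⁻¹ v, by simpa using V.add_mem (h _ (N.inv_mem ν.2) v) v.2⟩)
      (fun v => Subtype.ext ((ν : X ≃ᵢ X).apply_inv_self v))
      (fun v w => (ν : X ≃ᵢ X).edist_eq v w)
  map_one' := rfl
  map_mul' _ _ := rfl

lemma coe_restrictHom_apply (V : Submodule ℝ X) (h : ∀ ν ∈ N, ∀ x, ν x - x ∈ V) (ν : N)
    (v : V) : (restrictHom V h ν v : X) = (ν : X ≃ᵢ X) v := rfl

lemma restrictHom_injective (V : Submodule ℝ X) (h : ∀ ν ∈ N, ∀ x, ν x - x ∈ V) :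
    Function.Injective (restrictHom V h) := by
  rw [injective_iff_map_eq_one]
  refine fun ν hν => Subtype.ext (eq_one_of_apply_sub_mem (h ν ν.2) fun v hv => ?_)
  rw [← coe_restrictHom_apply V h ν ⟨v, hv⟩, hν]
  rfl

lemma transIso_mul {Y : Type*} [SeminormedAddCommGroup Y] (a b : Y) :
    transIso a * transIso b = transIso (a + b) := by
  ext x
  simp [IsometryEquiv.mul_apply, add_assoc]

end Isometries

section SpaceGroups

open Set

variable {X : Type*} [NormedAddCommGroup X] [InnerProductSpace ℝ X] [FiniteDimensional ℝ X]
  {Γ : Subgroup (X ≃ᵢ X)}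

lemma IsSpaceGroup.finite_norm_le (hΓ : IsSpaceGroup Γ) (R : ℝ) :
    {γ : X ≃ᵢ X | γ ∈ Γ ∧ ‖γ 0‖ ≤ R}.Finite := by
  have : ProperSpace X := FiniteDimensional.proper ℝ X
  refine (hΓ.1 (Metric.closedBall 0 R) (isCompact_closedBall _ _)).subset ?_
  rintro γ ⟨hγ, hR⟩
  refine ⟨hγ, γ 0, ⟨0, ?_, rfl⟩, by simpa using hR⟩
  simpa using (norm_nonneg _).trans hR

lemma IsSpaceGroup.exists_min_norm (hΓ : IsSpaceGroup Γ) {P : (X ≃ᵢ X) → Prop}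
    (hP : ∃ γ ∈ Γ, P γ) :
    ∃ γ ∈ Γ, P γ ∧ ∀ δ ∈ Γ, P δ → ‖γ 0‖ ≤ ‖δ 0‖ := by
  obtain ⟨γ₀, h₀, hP₀⟩ := hP
  have hfin : {γ : X ≃ᵢ X | (γ ∈ Γ ∧ ‖γ 0‖ ≤ ‖γ₀ 0‖) ∧ P γ}.Finite :=
    (hΓ.finite_norm_le ‖γ₀ 0‖).subset fun γ h => h.1
  obtain ⟨γ, ⟨⟨hγ, hle⟩, hPγ⟩, hmin⟩ :=
    exists_min_image _ (fun γ : X ≃ᵢ X => ‖γ 0‖) hfin ⟨γ₀, ⟨h₀, le_rfl⟩, hP₀⟩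
  refine ⟨γ, hγ, hPγ, fun δ hδ hPδ => ?_⟩
  by_cases h : ‖δ 0‖ ≤ ‖γ₀ 0‖
  · exact hmin δ ⟨⟨hδ, h⟩, hPδ⟩
  · exact hle.trans (not_le.1 h).le

/-- A space group contains elements with arbitrarily small linear part whose translation part
stays within bounded distance of arbitrarily distant points of a given ray. -/
lemma IsSpaceGroup.exists_near_ray (hΓ : IsSpaceGroup Γ) (u : X) {ε : ℝ} (hε : 0 < ε) :
    ∃ R : ℝ, 0 ≤ R ∧ ∀ T : ℝ, ∃ t : ℝ, T ≤ t ∧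
      ∃ β ∈ Γ, ‖rotDefect β‖ ≤ ε ∧ ‖β 0 - t • u‖ ≤ R := by
  obtain ⟨K, hK, hcov⟩ := hΓ.2
  obtain ⟨d, hd⟩ := hK.isBounded.exists_norm_le
  have hex : ∀ k : ℕ, ∃ γ ∈ Γ, ‖γ 0 - (k : ℝ) • u‖ ≤ d := by
    intro k
    obtain ⟨γ, hγ, hmem⟩ := hcov ((k : ℝ) • u)
    refine ⟨γ⁻¹, Γ.inv_mem hγ, ?_⟩
    rw [← dist_eq_norm, ← γ.dist_eq, IsometryEquiv.apply_inv_self, dist_zero_left]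
    exact hd _ hmem
  choose γ hγ hγd using hex
  have : ProperSpace (X →L[ℝ] X) := FiniteDimensional.proper ℝ _
  obtain ⟨_, -, s, hs, hlim⟩ := tendsto_subseq_of_bounded
    (Metric.isBounded_closedBall (x := (0 : X →L[ℝ] X)) (r := 2))
    (x := fun k => rotDefect (γ k)) fun k => by simpa using norm_rotDefect_le_two (γ k)
  obtain ⟨i, hi⟩ := Metric.cauchySeq_iff'.1 hlim.cauchySeq ε hε
  refine ⟨d + ‖γ (s i) 0‖, add_nonneg ((norm_nonneg _).trans (hγd 0)) (norm_nonneg _),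
    fun T => ?_⟩
  set j := max i ⌈T⌉₊
  refine ⟨s j, ?_, γ (s j) * (γ (s i))⁻¹, Γ.mul_mem (hγ _) (Γ.inv_mem (hγ _)), ?_, ?_⟩
  · refine (Nat.le_ceil T).trans ?_
    exact_mod_cast (le_max_right i ⌈T⌉₊).trans (hs.id_le j)
  · refine (norm_rotDefect_mul_inv_le _ _).trans ?_
    have := (hi j (le_max_left _ _)).le
    rwa [dist_eq_norm] at this
  · have h := apply_eq_add_linearPart (γ (s j) * (γ (s i))⁻¹) (γ (s i) 0)
    rw [← IsometryEquiv.mul_apply, inv_mul_cancel_right] at h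
    rw [← sub_eq_of_eq_add h, sub_right_comm]
    refine (norm_sub_le _ _).trans (add_le_add (hγd _) ?_)
    rw [LinearIsometryEquiv.norm_map]

/-- **Bieberbach**: an element of a space group with sufficiently small linear part is a
translation. -/
theorem IsSpaceGroup.rotDefect_eq_zero (hΓ : IsSpaceGroup Γ) {γ : X ≃ᵢ X} (hγ : γ ∈ Γ)
    (hsmall : ‖rotDefect γ‖ ≤ 1 / 4) : rotDefect γ = 0 := by
  by_contra hne
  obtain ⟨α, hα, ⟨hα0, hα4⟩, hαmin⟩ := hΓ.exists_min_norm
    (P := fun γ => rotDefect γ ≠ 0 ∧ ‖rotDefect γ‖ ≤ 1 / 4) ⟨γ, hγ, hne, hsmall⟩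
  set D := rotDefect α with hD
  set m := ‖D‖ with hm
  have hm0 : 0 < m := norm_pos_iff.2 hα0
  obtain ⟨u, hu⟩ : ∃ u : X, 3 / 4 * m * ‖u‖ < ‖D u‖ := by
    by_contra! h
    have := D.opNorm_le_bound (by positivity) h
    linarith
  have hu0 : 0 < ‖u‖ := by
    rw [norm_pos_iff]
    rintro rfl
    simp at hu
  -- the elements whose translation part is strongly expanded by `D`, relative to their rotation
  obtain ⟨β, hβ, ⟨hβ0, hβD⟩, hβmin⟩ := hΓ.exists_min_norm
    (P := fun β => β 0 ≠ 0 ∧ (m / 2 + 12 * ‖rotDefect β‖) * ‖β 0‖ ≤ ‖D (β 0)‖) (by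
      obtain ⟨R, hR, h⟩ := hΓ.exists_near_ray u (ε := m / 96) (by positivity)
      obtain ⟨t, ht, β, hβ, hβε, hβR⟩ := h (13 * (R + 1) / ‖u‖)
      have ht' : 13 * (R + 1) ≤ t * ‖u‖ := (div_le_iff₀ hu0).1 ht
      have ht0 : 0 ≤ t := by
        by_contra! hneg
        nlinarith
      have htu : ‖t • u‖ = t * ‖u‖ := by rw [norm_smul, Real.norm_of_nonneg ht0]
      have hlow : t * ‖u‖ - R ≤ ‖β 0‖ := by
        have := norm_sub_norm_le (t • u) (β 0)
        rw [norm_sub_rev] at this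
        linarith
      have hupp : ‖β 0‖ ≤ t * ‖u‖ + R := by
        have := norm_sub_norm_le (β 0) (t • u)
        linarith
      refine ⟨β, hβ, norm_pos_iff.1 (by linarith), ?_⟩
      have h1 : ‖D (β 0 - t • u)‖ ≤ m * R := D.le_opNorm_of_le hβR
      have h2 : 3 / 4 * m * (t * ‖u‖) ≤ ‖D (t • u)‖ := by
        rw [map_smul, norm_smul, Real.norm_of_nonneg ht0]
        nlinarith
      have h3 : ‖D (t • u)‖ - m * R ≤ ‖D (β 0)‖ := by
        have := norm_sub_norm_le (D (t • u)) (D (β 0))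
        rw [norm_sub_rev, ← map_sub] at this
        linarith
      have h4 : (m / 2 + 12 * ‖rotDefect β‖) * ‖β 0‖ ≤ 5 / 8 * m * (t * ‖u‖ + R) := by
        gcongr
        linarith
      nlinarith)
  set x := ‖β 0‖
  set y := ‖D (β 0)‖ with hy
  set e := ‖rotDefect β‖ with he
  have hx0 : 0 < x := norm_pos_iff.2 hβ0
  have he0 : 0 ≤ e := norm_nonneg _
  have hyx : y ≤ m * x := D.le_opNorm _
  have hem : m / 2 + 12 * e ≤ m := le_of_mul_le_mul_right (hβD.trans hyx) hx0
  have hax : e * ‖α 0‖ ≤ e * x := by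
    by_cases hB : rotDefect β = 0
    · simp [he, hB]
    · exact mul_le_mul_of_nonneg_left (hαmin β hβ ⟨hB, by linarith⟩) he0
  set c := α * β * α⁻¹ * β⁻¹ with hc
  have hcΓ : c ∈ Γ :=
    Γ.mul_mem (Γ.mul_mem (Γ.mul_mem hα hβ) (Γ.inv_mem hα)) (Γ.inv_mem hβ)
  have hce : ‖rotDefect c‖ ≤ e / 2 := by
    have : ‖rotDefect c‖ ≤ 2 * m * e := norm_rotDefect_commutator_le α β
    nlinarith
  have hr : ‖c 0 - D (β 0)‖ ≤ 2 * e * x := by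
    have : ‖c 0 - D (β 0)‖ ≤ 2 * m * e * x + e * ‖α 0‖ := norm_commutator_zero_sub_le α β
    nlinarith [mul_nonneg he0 hx0.le]
  have hcup : ‖c 0‖ ≤ y + 2 * e * x := by
    have := norm_sub_norm_le (c 0) (D (β 0))
    linarith
  have hclow : y - 2 * e * x ≤ ‖c 0‖ := by
    have := norm_sub_norm_le (D (β 0)) (c 0)
    rw [norm_sub_rev] at this
    linarith
  have hDc : ‖D (D (β 0))‖ - m * (2 * e * x) ≤ ‖D (c 0)‖ := by
    have h1 := norm_sub_norm_le (D (D (β 0))) (D (c 0))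
    rw [norm_sub_rev, ← map_sub] at h1
    have h2 := D.le_opNorm_of_le hr
    linarith
  have hsq : y ^ 2 ≤ ‖D (D (β 0))‖ * x := norm_rotDefect_sq_le α (β 0)
  have hex := mul_nonneg he0 hx0.le
  have hc0 : 0 < ‖c 0‖ := by nlinarith [mul_pos hm0 hx0]
  have hgrow : (m / 2 + 6 * e) * (y + 2 * e * x) ≤ ‖D (D (β 0))‖ - m * (2 * e * x) := by
    refine le_of_mul_le_mul_right ?_ hx0
    have h1 : (m / 2 + 6 * e) * x ≤ y - 6 * e * x := by linarith
    have h2 : ((m / 2 + 6 * e) * x) * (y + 2 * e * x) ≤ (y - 6 * e * x) * (y + 2 * e * x) := by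
      gcongr
    have h3 : 0 ≤ (e * x) * (y - m / 2 * x) :=
      mul_nonneg hex (by nlinarith)
    nlinarith [mul_nonneg hex hex]
  have hcD : (m / 2 + 12 * ‖rotDefect c‖) * ‖c 0‖ ≤ ‖D (c 0)‖ := by
    refine le_trans ?_ (hgrow.trans hDc)
    exact mul_le_mul (by linarith) hcup hc0.le (by positivity)
  have := hβmin c hcΓ ⟨norm_pos_iff.1 hc0, hcD⟩
  nlinarith

/-- **Bieberbach**: the translations of a space group span the whole space. -/
theorem IsSpaceGroup.spanOf_eq_top (hΓ : IsSpaceGroup Γ) : spanOf Γ = ⊤ := by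
  refine eq_top_iff.2 fun u _ => ?_
  obtain ⟨R, hR, h⟩ := hΓ.exists_near_ray u (ε := 1 / 4) (by norm_num)
  have hcl : IsClosed (spanOf Γ : Set X) := Submodule.closed_of_finiteDimensional _
  change u ∈ (spanOf Γ : Set X)
  rw [← hcl.closure_eq, Metric.mem_closure_iff]
  intro ε hε
  obtain ⟨t, ht, β, hβ, hβε, hβR⟩ := h ((R + 1) / ε)
  have ht0 : 0 < t := lt_of_lt_of_le (by positivity) ht
  have hβt : β 0 ∈ spanOf Γ := by
    refine Submodule.subset_span ?_
    change transIso (β 0) ∈ Γ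
    rwa [← eq_transIso_of_rotDefect_eq_zero (hΓ.rotDefect_eq_zero hβ hβε)]
  refine ⟨t⁻¹ • β 0, Submodule.smul_mem _ _ hβt, ?_⟩
  have hu : u = t⁻¹ • t • u := by rw [inv_smul_smul₀ ht0.ne']
  rw [hu, dist_eq_norm, ← smul_sub, norm_smul, norm_sub_rev, norm_inv,
    Real.norm_of_nonneg ht0.le, inv_mul_lt_iff₀ ht0]
  rw [div_le_iff₀ hε] at ht
  linarith

/-- Every element of a space group has a positive power that is a translation. -/
lemma IsSpaceGroup.exists_pow_rotDefect_eq_zero (hΓ : IsSpaceGroup Γ) {γ : X ≃ᵢ X}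
    (hγ : γ ∈ Γ) : ∃ k : ℕ, 0 < k ∧ rotDefect (γ ^ k) = 0 := by
  have : ProperSpace (X →L[ℝ] X) := FiniteDimensional.proper ℝ _
  obtain ⟨_, -, s, hs, hlim⟩ := tendsto_subseq_of_bounded
    (Metric.isBounded_closedBall (x := (0 : X →L[ℝ] X)) (r := 2))
    (x := fun k => rotDefect (γ ^ k)) fun k => by simpa using norm_rotDefect_le_two (γ ^ k)
  obtain ⟨i, hi⟩ := Metric.cauchySeq_iff'.1 hlim.cauchySeq (1 / 4) (by norm_num)
  have hlt : s i < s (i + 1) := hs i.lt_succ_self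
  refine ⟨s (i + 1) - s i, Nat.sub_pos_of_lt hlt,
    hΓ.rotDefect_eq_zero (Γ.pow_mem hγ _) ?_⟩
  rw [pow_sub γ hlt.le]
  refine (norm_rotDefect_mul_inv_le _ _).trans ?_
  have := (hi (i + 1) i.le_succ).le
  rwa [dist_eq_norm] at this

variable {N : Subgroup (X ≃ᵢ X)}

lemma IsSpaceGroup.rotDefect_mem_spanOf (hΓ : IsSpaceGroup Γ)
    (hN : ∀ γ ∈ Γ, ∀ ν ∈ N, γ * ν * γ⁻¹ ∈ N) {ν : X ≃ᵢ X} (hν : ν ∈ N) (x : X) :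
    rotDefect ν x ∈ spanOf N := by
  have hle : spanOf Γ ≤ (spanOf N).comap (rotDefect ν : X →ₗ[ℝ] X) := by
    refine Submodule.span_le.2 fun b (hb : transIso b ∈ Γ) => Submodule.subset_span ?_
    change transIso (rotDefect ν b) ∈ N
    have hmem := N.mul_mem hν (hN _ hb _ (N.inv_mem hν))
    convert hmem using 1
    rw [← mul_assoc, eq_mul_inv_iff_mul_eq, ← mul_assoc, eq_mul_inv_iff_mul_eq]
    ext z
    simp only [IsometryEquiv.mul_apply, transIso_apply]
    rw [add_comm b z, apply_add, rotDefect_apply]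
    abel
  rw [hΓ.spanOf_eq_top] at hle
  exact hle (Submodule.mem_top (x := x))

/-- An element of a normal subgroup `N` of a space group moves every point by a vector of the
span of `N`. -/
theorem IsSpaceGroup.apply_sub_mem_spanOf (hΓ : IsSpaceGroup Γ) (hNΓ : N ≤ Γ)
    (hN : ∀ γ ∈ Γ, ∀ ν ∈ N, γ * ν * γ⁻¹ ∈ N) {ν : X ≃ᵢ X} (hν : ν ∈ N) (x : X) :
    ν x - x ∈ spanOf N := by
  have hrot := hΓ.rotDefect_mem_spanOf hN hν
  have hstep : ∀ y, ν y - y - ν 0 ∈ spanOf N := fun y => by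
    have := hrot y
    rwa [rotDefect_apply, IsometryEquiv.toRealLinearIsometryEquiv_apply, sub_right_comm] at this
  have hpow : ∀ k : ℕ, (ν ^ k) 0 - (k : ℝ) • ν 0 ∈ spanOf N := by
    intro k
    induction k with
    | zero => simp
    | succ k ih =>
      have := (spanOf N).add_mem (hstep ((ν ^ k) 0)) ih
      convert this using 1
      rw [pow_succ', IsometryEquiv.mul_apply]
      push_cast
      module
  obtain ⟨k, hk, hk0⟩ := hΓ.exists_pow_rotDefect_eq_zero (hNΓ hν)
  have htr : (ν ^ k) 0 ∈ spanOf N := by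
    refine Submodule.subset_span ?_
    change transIso ((ν ^ k) 0) ∈ N
    rw [← eq_transIso_of_rotDefect_eq_zero hk0]
    exact N.pow_mem hν k
  have hk' : (k : ℝ) ≠ 0 := by exact_mod_cast hk.ne'
  have h0 : ν 0 ∈ spanOf N := by
    have := (spanOf N).sub_mem htr (hpow k)
    rw [sub_sub_cancel] at this
    exact ((spanOf N).smul_mem_iff hk').1 this
  simpa using (spanOf N).add_mem (hstep x) h0

/-- A group containing enough translations to span the space acts cocompactly. -/
lemma exists_compact_of_span_eq_top {H : Subgroup (X ≃ᵢ X)} (hH : spanOf H = ⊤) :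
    ∃ K : Set X, IsCompact K ∧ ∀ x : X, ∃ γ ∈ H, γ x ∈ K := by
  have : ProperSpace X := FiniteDimensional.proper ℝ X
  let b := Module.Basis.ofSpan hH.ge
  have := Module.Finite.finite_basis b
  have := Fintype.ofFinite ((linearIndepOn_empty ℝ (id : X → X)).extend
    (empty_subset {a : X | transIso a ∈ H}))
  let L : AddSubgroup X :=
    { carrier := {a | transIso a ∈ H}
      zero_mem' := by
        change transIso 0 ∈ H
        convert H.one_mem
        ext x
        exact zero_add x
      add_mem' := fun {a c} ha hc => by
        change transIso (a + c) ∈ H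
        rw [← transIso_mul]
        exact H.mul_mem ha hc
      neg_mem' := fun {a} ha => by
        change transIso (-a) ∈ H
        convert H.inv_mem ha using 1
        rw [eq_inv_iff_mul_eq_one, transIso_mul]
        ext x
        change -a + a + x = x
        simp }
  have hL : ∀ a ∈ Submodule.span ℤ (range b), transIso a ∈ H := by
    intro a ha
    exact (Submodule.span_le (p := AddSubgroup.toIntSubmodule L)).2
      (Module.Basis.ofSpan_subset hH.ge) ha
  refine ⟨Metric.closedBall 0 (∑ i, ‖b i‖), isCompact_closedBall _ _, fun x =>
    ⟨transIso (-(ZSpan.floor b x : X)), hL _ (neg_mem (ZSpan.floor b x).2), ?_⟩⟩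
  rw [mem_closedBall_zero_iff, transIso_apply, neg_add_eq_sub]
  exact ZSpan.norm_fract_le b x

lemma isSpaceGroup_range_restrictHom (hΓ : IsSpaceGroup Γ) (hNΓ : N ≤ Γ)
    (h : ∀ ν ∈ N, ∀ x, ν x - x ∈ spanOf N) :
    IsSpaceGroup (restrictHom (spanOf N) h).range := by
  refine ⟨fun K hK => ?_, exists_compact_of_span_eq_top ?_⟩
  · have hfin := hΓ.1 _ (hK.image continuous_subtype_val)
    refine ((hfin.preimage (Subtype.val_injective (p := (· ∈ N)).injOn)).image
      (restrictHom (spanOf N) h)).subset ?_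
    rintro _ ⟨⟨ν, rfl⟩, _, ⟨v, hv, rfl⟩, hw⟩
    exact ⟨ν, ⟨hNΓ ν.2, _, ⟨v, ⟨v, hv, rfl⟩, rfl⟩, ⟨_, hw, rfl⟩⟩, rfl⟩
  · have hspan := Submodule.span_span_coe_preimage (R := ℝ) (s := {a : X | transIso a ∈ N})
    refine eq_top_iff.2 (hspan.ge.trans (Submodule.span_mono ?_))
    intro a ha
    exact ⟨⟨transIso (a : X), ha⟩, rfl⟩

end SpaceGroups

/-- **Theorem 1(3)**: if `N` is a normal subgroup of an `n`-space group `Γ` and `V = Span N`,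
then `ν = a + A ↦ ν̄ = a + A|_V` is an injective homomorphism of `N` into the isometry
group of `V`, its image `N̄` is a space group of isometries of `V` (discrete with compact
orbit space), and `N` leaves each coset `V + x` invariant; hence `N` acts effectively on
each coset `V + x` of `V` in `Eⁿ` as a space group of isometries of `V + x`. -/
theorem normal_subgroup_acts_as_space_group_on_span {n : ℕ}
    (Γ N : Subgroup (EuclideanSpace ℝ (Fin n) ≃ᵢ EuclideanSpace ℝ (Fin n)))
    (hΓ : IsSpaceGroup Γ) (hNΓ : N ≤ Γ)
    (hNnormal : ∀ γ ∈ Γ, ∀ ν ∈ N, γ * ν * γ⁻¹ ∈ N) :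
    ∃ ρ : N →* (↥(spanOf N) ≃ᵢ ↥(spanOf N)),
      Function.Injective ρ ∧
      (∀ (ν : N) (a : EuclideanSpace ℝ (Fin n))
        (A : EuclideanSpace ℝ (Fin n) ≃ₗᵢ[ℝ] EuclideanSpace ℝ (Fin n)),
        parts (ν : EuclideanSpace ℝ (Fin n) ≃ᵢ EuclideanSpace ℝ (Fin n)) a A →
        ∀ v : ↥(spanOf N), ((ρ ν v : ↥(spanOf N)) : EuclideanSpace ℝ (Fin n)) = a + A ↑v) ∧
      IsSpaceGroup ρ.range ∧
      (∀ ν : N, ∀ x : EuclideanSpace ℝ (Fin n),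
        ((ν : EuclideanSpace ℝ (Fin n) ≃ᵢ EuclideanSpace ℝ (Fin n)) : _ → _) ''
            {y | ∃ v ∈ spanOf N, y = v + x} = {y | ∃ v ∈ spanOf N, y = v + x}) := by
  have h : ∀ ν ∈ N, ∀ x, ν x - x ∈ spanOf N := fun ν hν x =>
    hΓ.apply_sub_mem_spanOf hNΓ hNnormal hν x
  refine ⟨restrictHom (spanOf N) h, restrictHom_injective _ h, fun ν a A hp v => ?_,
    isSpaceGroup_range_restrictHom hΓ hNΓ h, fun ν x => Set.Subset.antisymm ?_ ?_⟩
  · rw [coe_restrictHom_apply, hp]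
  · rintro _ ⟨_, ⟨v, hv, rfl⟩, rfl⟩
    exact ⟨_, (spanOf N).add_mem (h ν ν.2 (v + x)) hv, by abel⟩
  · rintro _ ⟨v, hv, rfl⟩
    refine ⟨(ν : EuclideanSpace ℝ (Fin n) ≃ᵢ EuclideanSpace ℝ (Fin n))⁻¹ (v + x),
      ⟨_, (spanOf N).add_mem (h _ (N.inv_mem ν.2) (v + x)) hv, by abel⟩,
      IsometryEquiv.apply_inv_self _ _⟩
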